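/- Let θ be a real number. A graph G is θ-elementary if and only if the collection of nonempty θ-barrier sets of G forms a partition of V(G) (i.e., the nonempty θ-barrier sets are pairwise disjoint and their union is V(G)). -/

import Mathlib

open Polynomial

namespace MatchPoly

variable {V : Type*}

/-- The number of `r`-matchings in `G`: sets of `r` edges, no two sharing a vertex. -/
noncomputable def numMatchings (G : SimpleGraph V) (r : ℕ) : ℕ :=
  Nat.card {M : Finset (Sym2 V) // M.card = r ∧ (M : Set (Sym2 V)) ⊆ G.edgeSet ∧
    (M : Set (Sym2 V)).Pairwise fun e f => ∀ v : V, v ∈ e → v ∉ f}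

/-- The matching polynomial `μ(G,x) = ∑ (-1)^r p(G,r) x^(n-2r)`. -/
noncomputable def matchingPoly (G : SimpleGraph V) : Polynomial ℝ :=
  ∑ r ∈ Finset.range (Nat.card V + 1),
    Polynomial.C ((-1 : ℝ) ^ r * (numMatchings G r : ℝ)) *
      (Polynomial.X : Polynomial ℝ) ^ (Nat.card V - 2 * r)

/-- `mult θ G`: the multiplicity of `θ` as a root of `μ(G,x)`. -/
noncomputable def mult (θ : ℝ) (G : SimpleGraph V) : ℕ :=
  (matchingPoly G).rootMultiplicity θ

/-- `G \ X`: the induced subgraph on the complement of the vertex set `X`. -/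
def deleteSet (G : SimpleGraph V) (X : Set V) : SimpleGraph ↥(Xᶜ) :=
  G.induce (Xᶜ)

/-- `G \ v`: delete a single vertex. -/
def deleteVert (G : SimpleGraph V) (v : V) : SimpleGraph ↥({v}ᶜ : Set V) :=
  G.induce ({v}ᶜ : Set V)

/-- `u` is θ-essential: `mult(θ, G\u) = mult(θ,G) - 1`. -/
def IsEssential (θ : ℝ) (G : SimpleGraph V) (u : V) : Prop :=
  mult θ (deleteVert G u) + 1 = mult θ G

/-- `u` is θ-neutral: `mult(θ, G\u) = mult(θ,G)`. -/
def IsNeutral (θ : ℝ) (G : SimpleGraph V) (u : V) : Prop :=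
  mult θ (deleteVert G u) = mult θ G

/-- `u` is θ-positive: `mult(θ, G\u) = mult(θ,G) + 1`. -/
def IsPositive (θ : ℝ) (G : SimpleGraph V) (u : V) : Prop :=
  mult θ (deleteVert G u) = mult θ G + 1

/-- `u` is θ-special: not θ-essential but adjacent to a θ-essential vertex. -/
def IsSpecial (θ : ℝ) (G : SimpleGraph V) (u : V) : Prop :=
  ¬ IsEssential θ G u ∧ ∃ w : V, G.Adj u w ∧ IsEssential θ G w

/-- `A_θ(G)`: the set of θ-special vertices. -/
def specialSet (θ : ℝ) (G : SimpleGraph V) : Set V := {u | IsSpecial θ G u}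

/-- `N_θ(G)`: the set of θ-neutral vertices. -/
def neutralSet (θ : ℝ) (G : SimpleGraph V) : Set V := {u | IsNeutral θ G u}

/-- `P_θ(G)`: the set of θ-positive vertices that are not θ-special. -/
def positiveSet (θ : ℝ) (G : SimpleGraph V) : Set V :=
  {u | IsPositive θ G u ∧ ¬ IsSpecial θ G u}

/-- `G` is θ-super positive: `mult(θ,G) = 0` and `mult(θ,G\v) = 1` for every vertex `v`. -/
def IsSuperPositive (θ : ℝ) (G : SimpleGraph V) : Prop :=
  mult θ G = 0 ∧ ∀ v : V, mult θ (deleteVert G v) = 1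

/-- `G` is θ-elementary: θ-super positive and `P_θ(G\v) = ∅` for every vertex `v`. -/
def IsElementary (θ : ℝ) (G : SimpleGraph V) : Prop :=
  IsSuperPositive θ G ∧ ∀ v : V, positiveSet θ (deleteVert G v) = ∅

/-- `G` is θ-critical: every vertex is θ-essential and `mult(θ,G) = 1`. -/
def IsCritical (θ : ℝ) (G : SimpleGraph V) : Prop :=
  (∀ v : V, IsEssential θ G v) ∧ mult θ G = 1

/-- `c_θ(G)`: the number of θ-critical connected components of `G`. -/
noncomputable def numCritComponents (θ : ℝ) (G : SimpleGraph V) : ℕ :=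
  Nat.card {c : G.ConnectedComponent // IsCritical θ (G.induce c.supp)}

/-- `X` is a θ-barrier set: `mult(θ,G) = c_θ(G\X) - |X|`. -/
def IsBarrier (θ : ℝ) (G : SimpleGraph V) (X : Set V) : Prop :=
  numCritComponents θ (deleteSet G X) = mult θ G + X.ncard

/-- `X` is a θ-extreme set: `mult(θ,G\X) = mult(θ,G) + |X|`. -/
def IsExtreme (θ : ℝ) (G : SimpleGraph V) (X : Set V) : Prop :=
  mult θ (deleteSet G X) = mult θ G + X.ncard

/-- `G` is θ-base: θ-super positive and no θ-barrier set contains two adjacent vertices. -/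
def IsBase (θ : ℝ) (G : SimpleGraph V) : Prop :=
  IsSuperPositive θ G ∧
    ∀ X : Set V, IsBarrier θ G X → ∀ u v : V, u ∈ X → v ∈ X → ¬ G.Adj u v

section Local

variable {θ : ℝ}

/-- A polynomial nonnegative off a point is nonnegative there. -/
lemma eval_nonneg_of_forall_ne {f : ℝ[X]} (h : ∀ x, x ≠ θ → 0 ≤ f.eval x) : 0 ≤ f.eval θ :=
  ge_of_tendsto ((f.continuous.tendsto θ).mono_left nhdsWithin_le_nhds : Filter.Tendsto _
    (nhdsWithin θ {θ}ᶜ) _) (by filter_upwards [self_mem_nhdsWithin] with x hx using h x hx)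

lemma pow_even_dvd_of_nonneg {f : ℝ[X]} (hf : ∀ x, 0 ≤ f.eval x) {n : ℕ}
    (h : (X - C θ) ^ (2 * n + 1) ∣ f) : (X - C θ) ^ (2 * n + 2) ∣ f := by
  obtain ⟨g, rfl⟩ := h
  have key : ∀ x, 0 ≤ (x - θ) * g.eval x := by
    intro x
    rcases eq_or_ne x θ with rfl | hx
    · simp
    have h1 := hf x
    have h2 : 0 < (x - θ) ^ (2 * n) := (even_two_mul n).pow_pos (sub_ne_zero.2 hx)
    simp only [eval_mul, eval_pow, eval_sub, eval_X, eval_C] at h1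
    rw [pow_succ, mul_assoc] at h1
    exact nonneg_of_mul_nonneg_right h1 h2
  have h0 : g.eval θ = 0 := by
    apply le_antisymm
    · have hl : Filter.Tendsto (fun x => g.eval x) (nhdsWithin θ (Set.Iio θ))
          (nhds (g.eval θ)) := (g.continuous.tendsto θ).mono_left nhdsWithin_le_nhds
      refine le_of_tendsto hl ?_
      filter_upwards [self_mem_nhdsWithin] with x hx
      have := key x
      have hx' : x - θ < 0 := sub_neg.2 hx
      by_contra! hc
      nlinarith
    · have hl : Filter.Tendsto (fun x => g.eval x) (nhdsWithin θ (Set.Ioi θ))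
          (nhds (g.eval θ)) := (g.continuous.tendsto θ).mono_left nhdsWithin_le_nhds
      refine ge_of_tendsto hl ?_
      filter_upwards [self_mem_nhdsWithin] with x hx
      exact nonneg_of_mul_nonneg_right (key x) (sub_pos.2 hx)
  rw [pow_succ _ (2 * n + 1)]
  exact mul_dvd_mul_left _ (dvd_iff_isRoot.2 h0)

lemma pow_dvd_of_sq_le {n : ℕ} {f g : ℝ[X]} (hfg : ∀ x, g.eval x ^ 2 ≤ f.eval x)
    (h : (X - C θ) ^ (2 * n) ∣ f) : (X - C θ) ^ n ∣ g := by
  induction n generalizing f g with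
  | zero => simp
  | succ n ih =>
    obtain ⟨f', rfl⟩ := h
    have hroot : g.IsRoot θ := by
      have := hfg θ
      simp only [eval_mul, eval_pow, eval_sub, eval_X, eval_C, sub_self] at this
      rw [zero_pow (by omega), zero_mul] at this
      exact pow_eq_zero_iff (two_ne_zero) |>.1 (le_antisymm this (sq_nonneg _))
    obtain ⟨g', rfl⟩ := dvd_iff_isRoot.2 hroot
    rw [pow_succ']
    refine mul_dvd_mul_left _ (ih (f := (X - C θ) ^ (2 * n) * f') (fun x => ?_) (dvd_mul_right _ _))
    have off : ∀ x, x ≠ θ → 0 ≤ ((X - C θ) ^ (2 * n) * f' - g' ^ 2).eval x := by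
      intro x hx
      have h1 := hfg x
      have h2 : 0 < (x - θ) ^ 2 := by
        have := sub_ne_zero.2 hx
        positivity
      simp only [eval_mul, eval_pow, eval_sub, eval_X, eval_C] at h1 ⊢
      refine nonneg_of_mul_nonneg_right (a := (x - θ) ^ 2) ?_ h2
      have : (x - θ) ^ (2 * (n + 1)) = (x - θ) ^ 2 * (x - θ) ^ (2 * n) := by ring
      rw [this] at h1
      nlinarith
    have all : 0 ≤ ((X - C θ) ^ (2 * n) * f' - g' ^ 2).eval x := by
      rcases eq_or_ne x θ with rfl | hx
      · exact eval_nonneg_of_forall_ne off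
      · exact off x hx
    simpa using all

end Local

section Recurrence

variable [Finite V]

/-- The neighbours of `u` in `S`. -/
noncomputable def nbrsIn (G : SimpleGraph V) (S : Set V) (u : V) : Finset V :=
  (Set.toFinite {i | i ∈ S ∧ G.Adj u i}).toFinset

@[simp] lemma mem_nbrsIn {G : SimpleGraph V} {S : Set V} {u i : V} :
    i ∈ nbrsIn G S u ↔ i ∈ S ∧ G.Adj u i := by
  simp [nbrsIn]

lemma nbrsIn_sdiff_singleton_of_not_adj {G : SimpleGraph V} {S : Set V} {u v : V}
    (h : ¬ (v ∈ S ∧ G.Adj u v)) : nbrsIn G (S \ {v}) u = nbrsIn G S u := by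
  ext i
  by_cases hi : i = v
  · subst hi; simp [h]
  · simp [hi]

/-- The vertex-expansion recurrence of the matching polynomial, with vertex weights `y`,
for a function on induced subgraphs of `G`. -/
def VertexRec (G : SimpleGraph V) {R : Type*} [CommRing R] (y : V → R) (f : Set V → R) : Prop :=
  ∀ S u, u ∈ S → f S = y u * f (S \ {u}) - ∑ i ∈ nbrsIn G S u, f ((S \ {u}) \ {i})

lemma sum_nbrsIn_of_adj {G : SimpleGraph V} {S : Set V} {u v : V} (hv : v ∈ S)
    (h : G.Adj u v) {R : Type*} [CommRing R] (f : V → R) :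
    ∑ i ∈ nbrsIn G S u, f i = f v + ∑ i ∈ nbrsIn G (S \ {v}) u, f i := by
  classical
  have : nbrsIn G S u = insert v (nbrsIn G (S \ {v}) u) := by
    ext i
    by_cases hi : i = v
    · subst hi; simp [h, hv]
    · simp [hi]
  rw [this, Finset.sum_insert (by simp)]

variable {G : SimpleGraph V} {R : Type*} [CommRing R]

/-- Changing the weight of the vertex `a` preserves the recurrence. -/
lemma VertexRec.perturb {y z : V → R} {f g : Set V → R} (hf : VertexRec G y f) {a : V} {s : R}
    (hza : z a = y a - s) (hz : ∀ u, u ≠ a → z u = y u)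
    (hga : ∀ S, a ∈ S → g S = f S - s * f (S \ {a})) (hg : ∀ S, a ∉ S → g S = f S) :
    VertexRec G z g := by
  intro S u hu
  rcases eq_or_ne u a with rfl | hua
  · rw [hza, hga S hu, hg (S \ {u}) (by simp), hf S u hu]
    rw [Finset.sum_congr rfl fun i _ => hg ((S \ {u}) \ {i}) (by simp)]
    ring
  rw [hz u hua]
  by_cases ha : a ∈ S
  · have hsum : ∑ i ∈ nbrsIn G (S \ {a}) u, g ((S \ {u}) \ {i}) =
        ∑ i ∈ nbrsIn G (S \ {a}) u, f ((S \ {u}) \ {i}) -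
          s * ∑ i ∈ nbrsIn G (S \ {a}) u, f (((S \ {a}) \ {u}) \ {i}) := by
      rw [Finset.mul_sum, ← Finset.sum_sub_distrib]
      refine Finset.sum_congr rfl fun i hi => ?_
      rw [mem_nbrsIn] at hi
      rw [hga ((S \ {u}) \ {i}) ⟨⟨ha, hua.symm⟩, fun h => hi.1.2 h.symm⟩,
        sdiff_right_comm (S \ {u}), sdiff_right_comm S {u} {a}]
    have hrec : g S = z u * g (S \ {u}) - ∑ i ∈ nbrsIn G S u, g ((S \ {u}) \ {i}) := by
      rw [hz u hua, hga S ha, hga (S \ {u}) ⟨ha, hua.symm⟩, hf S u hu,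
        hf (S \ {a}) u ⟨hu, hua⟩, sdiff_right_comm S {u} {a}]
      by_cases hadj : G.Adj u a
      · rw [sum_nbrsIn_of_adj ha hadj, sum_nbrsIn_of_adj ha hadj (fun i => g _), hsum,
          hg ((S \ {u}) \ {a}) (by simp)]
        ring
      · have := nbrsIn_sdiff_singleton_of_not_adj (G := G) (S := S) (u := u) (v := a)
          (by tauto)
        rw [this] at hsum ⊢
        rw [hsum]
        ring
    rw [hrec, hz u hua]
  · rw [hg S ha, hg (S \ {u}) (fun h => ha h.1), hf S u hu]
    rw [Finset.sum_congr rfl fun i _ => hg ((S \ {u}) \ {i}) (fun h => ha h.1.1)]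

end Recurrence

section Inequality

variable [Finite V] {G : SimpleGraph V}

lemma VertexRec.wronskian_nonneg_and {y : V → ℝ} {f : Set V → ℝ} (hf : VertexRec G y f)
    (S : Set V) {u v : V} (hu : u ∈ S) (hv : v ∈ S) (huv : u ≠ v) :
    0 ≤ f (S \ {u}) * f (S \ {v}) - f S * f ((S \ {u}) \ {v}) ∧
    (G.Adj u v → f ((S \ {u}) \ {v}) ^ 2 ≤
      f (S \ {u}) * f (S \ {v}) - f S * f ((S \ {u}) \ {v})) := by
  induction hn : S.ncard generalizing S u with
  | zero =>
    rw [Set.ncard_eq_zero] at hn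
    simp [hn] at hu
  | succ n ih =>
    have hcard : (S \ {u}).ncard = n := by
      rw [Set.ncard_sdiff_singleton_of_mem hu, hn]; rfl
    have hnonneg : 0 ≤ ∑ i ∈ nbrsIn G (S \ {v}) u,
        (f ((S \ {u}) \ {i}) * f ((S \ {u}) \ {v}) -
          f (S \ {u}) * f (((S \ {u}) \ {v}) \ {i})) := by
      refine Finset.sum_nonneg fun i hi => ?_
      simp only [mem_nbrsIn, Set.mem_sdiff, Set.mem_singleton_iff] at hi
      rw [sdiff_right_comm (S \ {u})]
      exact (ih (S \ {u}) (u := i) ⟨hi.1.1, fun h => hi.2.ne h.symm⟩ ⟨hv, huv.symm⟩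
        hi.1.2 hcard).1
    rw [Finset.sum_sub_distrib, ← Finset.sum_mul, ← Finset.mul_sum] at hnonneg
    rw [hf S u hu, hf (S \ {v}) u ⟨hu, huv⟩, sdiff_right_comm S {v} {u}]
    by_cases hadj : G.Adj u v
    · rw [sum_nbrsIn_of_adj hv hadj]
      have := sq_nonneg (f ((S \ {u}) \ {v}))
      exact ⟨by linarith, fun _ => by linarith⟩
    · rw [nbrsIn_sdiff_singleton_of_not_adj (by tauto)] at hnonneg ⊢
      exact ⟨by linarith, fun h => absurd h hadj⟩

lemma VertexRec.wronskian_nonneg {y : V → ℝ} {f : Set V → ℝ} (hf : VertexRec G y f) (S : Set V)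
    {u v : V} (hu : u ∈ S) (hv : v ∈ S) (huv : u ≠ v) :
    0 ≤ f (S \ {u}) * f (S \ {v}) - f S * f ((S \ {u}) \ {v}) :=
  (hf.wronskian_nonneg_and S hu hv huv).1

/-- The discriminant of the Wronskian, as a quadratic in the weight of the vertex `a`, is
nonpositive. -/
lemma VertexRec.discrim_le {y : V → ℝ} {f : Set V → ℝ} (hf : VertexRec G y f) (S : Set V)
    {a u v : V} (ha : a ∈ S) (hu : u ∈ S) (hv : v ∈ S) (hau : a ≠ u) (hav : a ≠ v) (huv : u ≠ v) :
    (f (S \ {a}) * f ((S \ {u}) \ {v}) + f S * f (((S \ {a}) \ {u}) \ {v}) -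
        f ((S \ {a}) \ {u}) * f (S \ {v}) - f (S \ {u}) * f ((S \ {a}) \ {v})) ^ 2 ≤
      4 * (f (S \ {u}) * f (S \ {v}) - f S * f ((S \ {u}) \ {v})) *
        (f ((S \ {a}) \ {u}) * f ((S \ {a}) \ {v}) -
          f (S \ {a}) * f (((S \ {a}) \ {u}) \ {v})) := by
  classical
  have key := discrim_le_zero (K := ℝ)
    (a := f ((S \ {a}) \ {u}) * f ((S \ {a}) \ {v}) - f (S \ {a}) * f (((S \ {a}) \ {u}) \ {v}))
    (b := f (S \ {a}) * f ((S \ {u}) \ {v}) + f S * f (((S \ {a}) \ {u}) \ {v}) -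
        f ((S \ {a}) \ {u}) * f (S \ {v}) - f (S \ {u}) * f ((S \ {a}) \ {v}))
    (c := f (S \ {u}) * f (S \ {v}) - f S * f ((S \ {u}) \ {v})) ?_
  · rw [discrim] at key
    linarith
  · intro s
    have h := (hf.perturb (z := fun u => if u = a then y a - s else y u)
      (g := fun S => if a ∈ S then f S - s * f (S \ {a}) else f S) (if_pos rfl)
      (fun u hu => if_neg hu) (fun S hS => if_pos hS)
      (fun S hS => if_neg hS)).wronskian_nonneg S hu hv huv
    simp only [ha, Set.mem_sdiff, Set.mem_singleton_iff, hau, hav, not_false_eq_true, and_self,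
      if_true, sdiff_right_comm _ _ {a}] at h
    linarith

end Inequality

section Multiplicity

variable [Finite V] {G : SimpleGraph V} {F : Set V → ℝ[X]}

lemma VertexRec.eval {y : V → ℝ[X]} (hF : VertexRec G y F) (x : ℝ) :
    VertexRec G (fun u => (y u).eval x) (fun S => (F S).eval x) := by
  intro S u hu
  simp only
  rw [hF S u hu, eval_sub, eval_mul, eval_finsetSum]

lemma sum_toFinset_eq_add {S : Set V} {u : V} (hu : u ∈ S) {R : Type*} [CommRing R] (f : V → R) :
    ∑ i ∈ S.toFinite.toFinset, f i = f u + ∑ i ∈ (S \ {u}).toFinite.toFinset, f i := by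
  classical
  have : S.toFinite.toFinset = insert u (S \ {u}).toFinite.toFinset := by
    ext i
    by_cases hi : i = u
    · subst hi; simp [hu]
    · simp [hi]
  rw [this, Finset.sum_insert (by simp)]

/-- The derivative of the matching polynomial is the sum over the vertex-deleted subgraphs. -/
lemma VertexRec.derivative_eq (hF : VertexRec G (fun _ => X) F) (h0 : F ∅ = 1) (S : Set V) :
    derivative (F S) = ∑ i ∈ S.toFinite.toFinset, F (S \ {i}) := by
  induction hn : S.ncard using Nat.strong_induction_on generalizing S with
  | _ n ih =>
    rcases S.eq_empty_or_nonempty with rfl | ⟨u, hu⟩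
    · simp [h0]
    have hlt {T : Set V} {v : V} (hv : v ∈ T) : (T \ {v}).ncard < T.ncard :=
      Set.ncard_sdiff_singleton_lt_of_mem hv
    have h1 := ih _ (hn ▸ hlt hu) _ rfl
    have h2 : ∀ i ∈ nbrsIn G S u, derivative (F ((S \ {u}) \ {i})) =
        ∑ j ∈ ((S \ {u}) \ {i}).toFinite.toFinset, F (((S \ {u}) \ {j}) \ {i}) := by
      intro i hi
      rw [mem_nbrsIn] at hi
      rw [ih _ (hn ▸ (hlt (T := S \ {u}) ⟨hi.1, hi.2.ne'⟩).trans (hlt hu)) _ rfl]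
      exact Finset.sum_congr rfl fun j _ => by rw [sdiff_right_comm]
    have h3 : ∀ j ∈ (S \ {u}).toFinite.toFinset, F (S \ {j}) = X * F ((S \ {u}) \ {j}) -
        ∑ i ∈ nbrsIn G (S \ {j}) u, F (((S \ {u}) \ {j}) \ {i}) := by
      intro j hj
      simp only [Set.Finite.mem_toFinset, Set.mem_sdiff, Set.mem_singleton_iff] at hj
      rw [hF (S \ {j}) u ⟨hu, fun h => hj.2 h.symm⟩, sdiff_right_comm S {j} {u}]
    rw [sum_toFinset_eq_add hu, Finset.sum_congr rfl h3, Finset.sum_sub_distrib, ← Finset.mul_sum,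
      ← h1, hF S u hu, derivative_sub, derivative_mul, derivative_X, derivative_sum,
      Finset.sum_congr rfl h2, one_mul, add_sub_assoc]
    congr 2
    refine Finset.sum_comm' fun i j => ?_
    simp only [mem_nbrsIn, Set.Finite.mem_toFinset, Set.mem_sdiff, Set.mem_singleton_iff]
    grind

lemma VertexRec.sq_le_wronskian_derivative (hF : VertexRec G (fun _ => X) F) (h0 : F ∅ = 1)
    {S : Set V} {u : V} (hu : u ∈ S) (x : ℝ) :
    (F (S \ {u})).eval x ^ 2 ≤
      (derivative (F S) * F (S \ {u}) - F S * derivative (F (S \ {u}))).eval x := by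
  rw [hF.derivative_eq h0, hF.derivative_eq h0, sum_toFinset_eq_add hu]
  have : 0 ≤ ∑ i ∈ (S \ {u}).toFinite.toFinset,
      ((F (S \ {u})).eval x * (F (S \ {i})).eval x -
        (F S).eval x * (F ((S \ {u}) \ {i})).eval x) := by
    refine Finset.sum_nonneg fun i hi => ?_
    simp only [Set.Finite.mem_toFinset, Set.mem_sdiff, Set.mem_singleton_iff] at hi
    exact (hF.eval x).wronskian_nonneg S hu hi.1 (fun h => hi.2 h.symm)
  rw [Finset.sum_sub_distrib, ← Finset.mul_sum, ← Finset.mul_sum] at this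
  simp only [eval_sub, eval_mul, eval_add, eval_finsetSum]
  linarith

lemma VertexRec.ne_zero (hF : VertexRec G (fun _ => X) F) (h0 : F ∅ = 1) (S : Set V) :
    F S ≠ 0 := by
  induction hn : S.ncard using Nat.strong_induction_on generalizing S with
  | _ n ih =>
    rcases S.eq_empty_or_nonempty with rfl | ⟨u, hu⟩
    · simp [h0]
    intro hS
    refine ih _ (hn ▸ Set.ncard_sdiff_singleton_lt_of_mem hu) (S \ {u}) rfl ?_
    refine Polynomial.funext fun x => ?_
    have := hF.sq_le_wronskian_derivative h0 hu x
    rw [hS] at this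
    simp only [derivative_zero, zero_mul, sub_self, eval_zero] at this ⊢
    nlinarith

variable {θ : ℝ}

lemma VertexRec.pow_dvd_iff (hF : VertexRec G (fun _ => X) F) (h0 : F ∅ = 1) {S : Set V} {n : ℕ} :
    (X - C θ) ^ n ∣ F S ↔ n ≤ (F S).rootMultiplicity θ :=
  (le_rootMultiplicity_iff (hF.ne_zero h0 S)).symm

lemma VertexRec.pow_dvd_mul (hF : VertexRec G (fun _ => X) F) (h0 : F ∅ = 1) {S T : Set V} {n : ℕ}
    (h : n ≤ (F S).rootMultiplicity θ + (F T).rootMultiplicity θ) :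
    (X - C θ) ^ n ∣ F S * F T := by
  rw [← le_rootMultiplicity_iff (mul_ne_zero (hF.ne_zero h0 S) (hF.ne_zero h0 T)),
    rootMultiplicity_mul (mul_ne_zero (hF.ne_zero h0 S) (hF.ne_zero h0 T))]
  exact h

lemma VertexRec.le_of_pow_dvd_mul (hF : VertexRec G (fun _ => X) F) (h0 : F ∅ = 1) {S T : Set V}
    {n : ℕ} (h : (X - C θ) ^ n ∣ F S * F T) :
    n ≤ (F S).rootMultiplicity θ + (F T).rootMultiplicity θ := by
  rwa [← le_rootMultiplicity_iff (mul_ne_zero (hF.ne_zero h0 S) (hF.ne_zero h0 T)),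
    rootMultiplicity_mul (mul_ne_zero (hF.ne_zero h0 S) (hF.ne_zero h0 T))] at h

lemma VertexRec.rootMultiplicity_le (hF : VertexRec G (fun _ => X) F) (h0 : F ∅ = 1) {S : Set V}
    {u : V} (hu : u ∈ S) :
    (F S).rootMultiplicity θ ≤ (F (S \ {u})).rootMultiplicity θ + 1 := by
  by_contra! hlt
  obtain ⟨n, hn⟩ : ∃ n, (F S).rootMultiplicity θ = n + 1 :=
    ⟨_, (Nat.sub_add_cancel (by omega)).symm⟩
  have hj : ∀ j, j ≤ n → (X - C θ) ^ j ∣ F (S \ {u}) := by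
    intro j
    induction j with
    | zero => simp
    | succ j ih =>
      intro hjn
      have hq := ih (by omega)
      have hp : (X - C θ) ^ (n + 1) ∣ F S := (hF.pow_dvd_iff h0).2 hn.ge
      have hp' : (X - C θ) ^ n ∣ derivative (F S) := by
        simpa using pow_sub_one_dvd_derivative_of_pow_dvd hp
      have hq' : (X - C θ) ^ (j - 1) ∣ derivative (F (S \ {u})) :=
        pow_sub_one_dvd_derivative_of_pow_dvd hq
      have hd : (X - C θ) ^ (2 * j + 1) ∣
          derivative (F S) * F (S \ {u}) - F S * derivative (F (S \ {u})) := by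
        refine dvd_sub ((pow_dvd_pow _ ?_).trans ((pow_add (X - C θ) n j).symm ▸ mul_dvd_mul hp' hq))
          ((pow_dvd_pow _ ?_).trans
            ((pow_add (X - C θ) (n + 1) (j - 1)).symm ▸ mul_dvd_mul hp hq')) <;> omega
      have hge := hF.sq_le_wronskian_derivative h0 hu
      exact pow_dvd_of_sq_le hge
        (pow_even_dvd_of_nonneg (fun x => (sq_nonneg _).trans (hge x)) hd)
  have := (hF.pow_dvd_iff h0).1 (hj n le_rfl)
  omega

lemma VertexRec.le_rootMultiplicity_add_one (hF : VertexRec G (fun _ => X) F) (h0 : F ∅ = 1)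
    {S : Set V} {u : V} (hu : u ∈ S) :
    (F (S \ {u})).rootMultiplicity θ ≤ (F S).rootMultiplicity θ + 1 := by
  obtain h | ⟨n, hn⟩ : (F (S \ {u})).rootMultiplicity θ = 0 ∨
      ∃ n, (F (S \ {u})).rootMultiplicity θ = n + 1 := by
    cases (F (S \ {u})).rootMultiplicity θ <;> simp
  · omega
  rw [hn, Nat.add_le_add_iff_right, ← hF.pow_dvd_iff h0, hF S u hu]
  refine dvd_sub (Dvd.dvd.mul_left ((hF.pow_dvd_iff h0).2 (by omega)) _)
    (Finset.dvd_sum fun i hi => (hF.pow_dvd_iff h0).2 ?_)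
  rw [mem_nbrsIn] at hi
  have := hF.rootMultiplicity_le h0 (θ := θ) (S := S \ {u}) (u := i) ⟨hi.1, hi.2.ne'⟩
  omega

lemma VertexRec.exists_essential (hF : VertexRec G (fun _ => X) F) (h0 : F ∅ = 1)
    {S : Set V} (h : 0 < (F S).rootMultiplicity θ) :
    ∃ u ∈ S, (F (S \ {u})).rootMultiplicity θ + 1 = (F S).rootMultiplicity θ := by
  by_contra! hne
  have hroot : (F S).IsRoot θ := (rootMultiplicity_pos (hF.ne_zero h0 S)).1 h
  have hder := derivative_rootMultiplicity_of_root hroot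
  have hdvd : (X - C θ) ^ ((F S).rootMultiplicity θ) ∣ derivative (F S) := by
    rw [hF.derivative_eq h0]
    refine Finset.dvd_sum fun i hi => (hF.pow_dvd_iff h0).2 ?_
    rw [Set.Finite.mem_toFinset] at hi
    have h1 := hF.rootMultiplicity_le h0 (θ := θ) hi
    have h2 := hne i hi
    omega
  have hd0 : derivative (F S) ≠ 0 := by
    intro hd
    have := derivative_eq_zero.1 hd
    rw [eq_C_of_natDegree_eq_zero this, rootMultiplicity_C] at h
    exact lt_irrefl _ h
  rw [← le_rootMultiplicity_iff hd0] at hdvd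
  omega

/-- A nonessential neighbour of an essential vertex is positive. -/
lemma VertexRec.positive_of_special (hF : VertexRec G (fun _ => X) F) (h0 : F ∅ = 1)
    {S : Set V} {u v : V} (hu : u ∈ S) (hv : v ∈ S) (huv : G.Adj u v)
    (hev : (F (S \ {v})).rootMultiplicity θ + 1 = (F S).rootMultiplicity θ)
    (hnu : (F (S \ {u})).rootMultiplicity θ + 1 ≠ (F S).rootMultiplicity θ) :
    (F (S \ {u})).rootMultiplicity θ = (F S).rootMultiplicity θ + 1 := by
  by_contra hne
  have b1 := hF.rootMultiplicity_le h0 (θ := θ) hu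
  have b2 := hF.le_rootMultiplicity_add_one h0 (θ := θ) hu
  have b3 := hF.rootMultiplicity_le h0 (θ := θ) (S := S \ {u}) (u := v) ⟨hv, huv.ne'⟩
  obtain ⟨k, hk⟩ : ∃ k, (F (S \ {v})).rootMultiplicity θ = k := ⟨_, rfl⟩
  have hW : (X - C θ) ^ (2 * k + 1) ∣
      F (S \ {u}) * F (S \ {v}) - F S * F ((S \ {u}) \ {v}) :=
    dvd_sub (hF.pow_dvd_mul h0 (by omega)) (hF.pow_dvd_mul h0 (by omega))
  have hsq (x : ℝ) : (F ((S \ {u}) \ {v})).eval x ^ 2 ≤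
      (F (S \ {u}) * F (S \ {v}) - F S * F ((S \ {u}) \ {v})).eval x := by
    simpa using ((hF.eval x).wronskian_nonneg_and S hu hv huv.ne).2 huv
  have hW' := pow_even_dvd_of_nonneg (fun x => (sq_nonneg _).trans (hsq x)) hW
  have h3 := (hF.pow_dvd_iff h0).1 (pow_dvd_of_sq_le (n := k + 1) hsq hW')
  have h4 := (dvd_sub_left (hF.pow_dvd_mul h0 (S := S) (T := (S \ {u}) \ {v}) (n := 2 * k + 2)
    (by omega))).1 hW'
  have := hF.le_of_pow_dvd_mul h0 h4
  omega

lemma VertexRec.le_of_adj_essential (hF : VertexRec G (fun _ => X) F) (h0 : F ∅ = 1)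
    {S : Set V} {u v : V} (hu : u ∈ S) (hv : v ∈ S) (huv : G.Adj u v)
    (heu : (F (S \ {u})).rootMultiplicity θ + 1 = (F S).rootMultiplicity θ)
    (hev : (F (S \ {v})).rootMultiplicity θ + 1 = (F S).rootMultiplicity θ) :
    (F S).rootMultiplicity θ ≤ (F ((S \ {u}) \ {v})).rootMultiplicity θ + 1 := by
  have b3 := hF.rootMultiplicity_le h0 (θ := θ) (S := S \ {u}) (u := v) ⟨hv, huv.ne'⟩
  obtain ⟨k, hk⟩ : ∃ k, (F (S \ {v})).rootMultiplicity θ = k := ⟨_, rfl⟩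
  have hW : (X - C θ) ^ (2 * k) ∣
      F (S \ {u}) * F (S \ {v}) - F S * F ((S \ {u}) \ {v}) :=
    dvd_sub (hF.pow_dvd_mul h0 (by omega)) (hF.pow_dvd_mul h0 (by omega))
  have h3 := (hF.pow_dvd_iff h0).1 (pow_dvd_of_sq_le (n := k) (fun x => by
    simpa using ((hF.eval x).wronskian_nonneg_and S hu hv huv.ne).2 huv) hW)
  omega

/-- Divisibility form of the discriminant inequality. -/
lemma VertexRec.pow_dvd_discrim (hF : VertexRec G (fun _ => X) F) (S : Set V) {n : ℕ}
    {a u v : V} (ha : a ∈ S) (hu : u ∈ S) (hv : v ∈ S) (hau : a ≠ u) (hav : a ≠ v) (huv : u ≠ v)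
    (h1 : (X - C θ) ^ n ∣ F (S \ {u}) * F (S \ {v}) - F S * F ((S \ {u}) \ {v}))
    (h2 : (X - C θ) ^ n ∣ F ((S \ {a}) \ {u}) * F ((S \ {a}) \ {v}) -
          F (S \ {a}) * F (((S \ {a}) \ {u}) \ {v})) :
    (X - C θ) ^ n ∣ F (S \ {a}) * F ((S \ {u}) \ {v}) + F S * F (((S \ {a}) \ {u}) \ {v}) -
        F ((S \ {a}) \ {u}) * F (S \ {v}) - F (S \ {u}) * F ((S \ {a}) \ {v}) := by
  refine pow_dvd_of_sq_le (f := C 4 * (F (S \ {u}) * F (S \ {v}) - F S * F ((S \ {u}) \ {v})) *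
    (F ((S \ {a}) \ {u}) * F ((S \ {a}) \ {v}) - F (S \ {a}) * F (((S \ {a}) \ {u}) \ {v})))
    (fun x => ?_) ?_
  · simpa using (hF.eval x).discrim_le S ha hu hv hau hav huv
  · rw [two_mul, pow_add]
    exact mul_dvd_mul (h1.mul_left _) h2

/-- **Stability lemma**: deleting a special vertex creates no new essential vertices. -/
lemma VertexRec.not_essential_of_special (hF : VertexRec G (fun _ => X) F) (h0 : F ∅ = 1)
    {S : Set V} {a v b : V} (ha : a ∈ S) (hv : v ∈ S) (hb : b ∈ S) (hab : a ≠ b) (hav : G.Adj a v)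
    (hev : (F (S \ {v})).rootMultiplicity θ + 1 = (F S).rootMultiplicity θ)
    (hna : (F (S \ {a})).rootMultiplicity θ + 1 ≠ (F S).rootMultiplicity θ)
    (hnb : (F (S \ {b})).rootMultiplicity θ + 1 ≠ (F S).rootMultiplicity θ) :
    (F ((S \ {a}) \ {b})).rootMultiplicity θ + 1 ≠ (F (S \ {a})).rootMultiplicity θ := by
  intro hcon
  have pa := hF.positive_of_special h0 ha hv hav hev hna
  have hvb : v ≠ b := by rintro rfl; exact hnb hev
  obtain ⟨k, hk⟩ : ∃ k, (F (S \ {v})).rootMultiplicity θ = k := ⟨_, rfl⟩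
  have c1 : (S \ {b}) \ {a} = (S \ {a}) \ {b} := sdiff_right_comm ..
  have b1 := hF.rootMultiplicity_le h0 (θ := θ) hb
  have b2 := hF.le_rootMultiplicity_add_one h0 (θ := θ) hb
  have b3 := hF.rootMultiplicity_le h0 (θ := θ) (S := S \ {b}) (u := v) ⟨hv, hvb⟩
  have b4 := hF.le_rootMultiplicity_add_one h0 (θ := θ) (S := S \ {v}) (u := b) ⟨hb, hvb.symm⟩
  have b5 := hF.rootMultiplicity_le h0 (θ := θ) (S := S \ {a}) (u := v) ⟨hv, hav.ne'⟩
  have b6 := hF.le_rootMultiplicity_add_one h0 (θ := θ) (S := S \ {v}) (u := a) ⟨ha, hav.ne⟩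
  rw [sdiff_right_comm S {v} {a}] at b6
  rw [sdiff_right_comm S {b} {v}] at b3
  rcases eq_or_ne ((F (S \ {b})).rootMultiplicity θ) (k + 1) with hbk | hbk
  · by_cases hvbk : (F ((S \ {v}) \ {b})).rootMultiplicity θ = k
    · have := hF.positive_of_special h0 (θ := θ) (S := S \ {b}) ⟨ha, hab⟩ ⟨hv, hvb⟩ hav
        (by rw [sdiff_right_comm S {b} {v}]; omega) (by rw [c1]; omega)
      rw [c1] at this
      omega
    · have hW : (X - C θ) ^ (2 * k + 1) ∣
          F (S \ {v}) * F (S \ {b}) - F S * F ((S \ {v}) \ {b}) :=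
        dvd_sub (hF.pow_dvd_mul h0 (by omega)) (hF.pow_dvd_mul h0 (by omega))
      have hW' := pow_even_dvd_of_nonneg (fun x => by
        simpa using (hF.eval x).wronskian_nonneg S hv hb hvb) hW
      have h4 := (dvd_sub_left (hF.pow_dvd_mul h0 (S := S) (T := (S \ {v}) \ {b})
        (n := 2 * k + 2) (by omega))).1 hW'
      have := hF.le_of_pow_dvd_mul h0 h4
      omega
  · have hadj := hF.le_of_adj_essential h0 (θ := θ) (S := S \ {b}) ⟨ha, hab⟩ ⟨hv, hvb⟩ hav
      (by rw [c1]; omega) (by rw [sdiff_right_comm S {b} {v}]; omega)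
    rw [c1, sdiff_right_comm (S \ {a}) {b} {v}] at hadj
    have hd := hF.pow_dvd_discrim (θ := θ) S (n := 2 * k + 2) ha hv hb hav.ne hab hvb
      (dvd_sub (hF.pow_dvd_mul h0 (by omega)) (hF.pow_dvd_mul h0 (by omega)))
      (dvd_sub (hF.pow_dvd_mul h0 (by omega)) (hF.pow_dvd_mul h0 (by omega)))
    rw [dvd_sub_right (dvd_sub (dvd_add (hF.pow_dvd_mul h0 (by omega))
      (hF.pow_dvd_mul h0 (by omega))) (hF.pow_dvd_mul h0 (by omega)))] at hd
    have := hF.le_of_pow_dvd_mul h0 hd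
    omega

lemma VertexRec.essential_of_positive (hF : VertexRec G (fun _ => X) F) (h0 : F ∅ = 1)
    {S : Set V} {a b : V} (ha : a ∈ S) (hb : b ∈ S) (hab : a ≠ b)
    (hpa : (F (S \ {a})).rootMultiplicity θ = (F S).rootMultiplicity θ + 1)
    (heb : (F (S \ {b})).rootMultiplicity θ + 1 = (F S).rootMultiplicity θ) :
    (F ((S \ {a}) \ {b})).rootMultiplicity θ + 1 = (F (S \ {a})).rootMultiplicity θ := by
  have b1 := hF.rootMultiplicity_le h0 (θ := θ) (S := S \ {a}) (u := b) ⟨hb, hab.symm⟩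
  have b2 := hF.le_rootMultiplicity_add_one h0 (θ := θ) (S := S \ {b}) (u := a) ⟨ha, hab⟩
  rw [sdiff_right_comm S {b} {a}] at b2
  omega

lemma VertexRec.essential_pair_trans (hF : VertexRec G (fun _ => X) F) (h0 : F ∅ = 1)
    {S : Set V} (hS : ∀ u ∈ S, (F (S \ {u})).rootMultiplicity θ + 1 = (F S).rootMultiplicity θ)
    {u v w : V} (hu : u ∈ S) (hv : v ∈ S) (hw : w ∈ S) (hvu : v ≠ u) (hvw : v ≠ w) (huw : u ≠ w)
    (h1 : (F S).rootMultiplicity θ ≤ (F ((S \ {v}) \ {u})).rootMultiplicity θ + 1)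
    (h2 : (F S).rootMultiplicity θ ≤ (F ((S \ {v}) \ {w})).rootMultiplicity θ + 1) :
    (F S).rootMultiplicity θ ≤ (F ((S \ {u}) \ {w})).rootMultiplicity θ + 1 := by
  by_contra! hlt
  have eu := hS u hu
  have ev := hS v hv
  have ew := hS w hw
  have b1 := hF.rootMultiplicity_le h0 (θ := θ) (S := S \ {u}) (u := w) ⟨hw, huw.symm⟩
  have b2 := hF.rootMultiplicity_le h0 (θ := θ) (S := (S \ {v}) \ {u}) (u := w)
    ⟨⟨hw, hvw.symm⟩, huw.symm⟩
  obtain ⟨k, hk⟩ : ∃ k, (F ((S \ {u}) \ {w})).rootMultiplicity θ = k := ⟨_, rfl⟩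
  have hW : (X - C θ) ^ (2 * k + 1) ∣
      F ((S \ {v}) \ {u}) * F ((S \ {v}) \ {w}) - F (S \ {v}) * F (((S \ {v}) \ {u}) \ {w}) :=
    dvd_sub (hF.pow_dvd_mul h0 (by omega)) (hF.pow_dvd_mul h0 (by omega))
  have hW' := pow_even_dvd_of_nonneg (fun x => by
    simpa using (hF.eval x).wronskian_nonneg (S \ {v}) ⟨hu, hvu.symm⟩ ⟨hw, hvw.symm⟩ huw) hW
  have hd := hF.pow_dvd_discrim (θ := θ) S (n := 2 * k + 2) hv hu hw hvu hvw huw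
      (dvd_sub (hF.pow_dvd_mul h0 (by omega)) (hF.pow_dvd_mul h0 (by omega))) hW'
  rw [dvd_sub_left (hF.pow_dvd_mul h0 (by omega)), dvd_sub_left (hF.pow_dvd_mul h0 (by omega)),
    dvd_add_left (hF.pow_dvd_mul h0 (by omega))] at hd
  have := hF.le_of_pow_dvd_mul h0 hd
  omega

end Multiplicity

section InducedPoly

variable {G : SimpleGraph V}

/-- The `r`-matchings of `G` all of whose edges lie inside `S`. -/
def matchingsIn (G : SimpleGraph V) (S : Set V) (r : ℕ) : Set (Finset (Sym2 V)) :=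
  {M | M.card = r ∧ (∀ e ∈ M, e ∈ G.edgeSet ∧ ∀ v ∈ e, v ∈ S) ∧
    (M : Set (Sym2 V)).Pairwise fun e f => ∀ v : V, v ∈ e → v ∉ f}

/-- The matching polynomial of the subgraph of `G` induced on `S`. -/
noncomputable def inducedPoly (G : SimpleGraph V) (S : Set V) : ℝ[X] :=
  ∑ r ∈ Finset.range (S.ncard + 1),
    C ((-1 : ℝ) ^ r * ((matchingsIn G S r).ncard : ℝ)) * X ^ (S.ncard - 2 * r)

lemma numMatchings_eq_ncard {W : Type*} {H : SimpleGraph W} (φ : H ↪g G) (r : ℕ) :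
    numMatchings H r = (matchingsIn G (Set.range φ) r).ncard := by
  let ψ : Sym2 W ↪ Sym2 V := φ.toEmbedding.sym2Map
  have hmem : ∀ e v, φ v ∈ ψ e ↔ v ∈ e := by
    intro e v
    simp only [ψ, Function.Embedding.sym2Map_apply, Sym2.mem_map]
    exact ⟨fun ⟨a, ha, h⟩ => φ.injective h ▸ ha, fun h => ⟨v, h, rfl⟩⟩
  have hex : ∀ e, ∀ v ∈ ψ e, ∃ w ∈ e, φ w = v := by
    intro e v hv
    exact Sym2.mem_map.1 hv
  have hedge : ∀ e, ψ e ∈ G.edgeSet ↔ e ∈ H.edgeSet := by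
    intro e
    induction e with
    | _ x y => simp [ψ]
  have hrange : ∀ e : Sym2 V, (∀ v ∈ e, v ∈ Set.range φ) → ∃ e', ψ e' = e := by
    intro e
    induction e with
    | _ x y =>
      intro h
      obtain ⟨x', hx⟩ := h x (by simp)
      obtain ⟨y', hy⟩ := h y (by simp)
      exact ⟨s(x', y'), by simp [ψ, hx, hy]⟩
  have : matchingsIn G (Set.range φ) r = Finset.map ψ '' {M : Finset (Sym2 W) | M.card = r ∧
      (M : Set (Sym2 W)) ⊆ H.edgeSet ∧
      (M : Set (Sym2 W)).Pairwise fun e f => ∀ v : W, v ∈ e → v ∉ f} := by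
    ext M
    constructor
    · rintro ⟨hc, hM, hp⟩
      have hmap : (M.preimage ψ ψ.injective.injOn).map ψ = M := by
        ext e
        simp only [Finset.mem_map, Finset.mem_preimage]
        constructor
        · rintro ⟨e', he', rfl⟩
          exact he'
        · intro he
          obtain ⟨e', rfl⟩ := hrange e (hM e he).2
          exact ⟨e', he, rfl⟩
      refine ⟨M.preimage ψ ψ.injective.injOn, ⟨?_, fun e he => ?_, ?_⟩, hmap⟩
      · rw [← hc, ← Finset.card_map ψ, hmap]
      · exact (hedge e).1 (hM _ (by simpa using he)).1
      · intro e he f hf hef v hve hvf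
        exact hp (by simpa using he) (by simpa using hf) (ψ.injective.ne hef) (φ v)
          ((hmem e v).2 hve) ((hmem f v).2 hvf)
    · rintro ⟨M, ⟨hc, hM, hp⟩, rfl⟩
      refine ⟨by simpa using hc, ?_, ?_⟩
      · intro e he
        obtain ⟨e, he', rfl⟩ := Finset.mem_map.1 he
        refine ⟨(hedge e).2 (hM he'), fun v hv => ?_⟩
        obtain ⟨w, -, rfl⟩ := hex e v hv
        exact ⟨w, rfl⟩
      · intro e he f hf hef v hve hvf
        obtain ⟨e, he', rfl⟩ := Finset.mem_map.1 he
        obtain ⟨f, hf', rfl⟩ := Finset.mem_map.1 hf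
        obtain ⟨w, hw, rfl⟩ := hex e v hve
        exact hp he' hf' (fun h => hef (congrArg ψ h)) w hw ((hmem f w).1 hvf)
  rw [this, Set.ncard_image_of_injective _ (Finset.map_injective ψ)]
  rfl

lemma matchingPoly_eq_inducedPoly {W : Type*} {H : SimpleGraph W} (φ : H ↪g G) :
    matchingPoly H = inducedPoly G (Set.range φ) := by
  have hc : (Set.range φ).ncard = Nat.card W := by
    rw [← Set.image_univ, Set.ncard_image_of_injective _ φ.injective, Set.ncard_univ]
  rw [matchingPoly, inducedPoly, hc]
  simp only [numMatchings_eq_ncard φ]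

lemma matchingsIn_zero (S : Set V) : matchingsIn G S 0 = {∅} := by
  ext M
  simp only [matchingsIn, Finset.card_eq_zero, Set.mem_ofPred_eq, Set.mem_singleton_iff]
  constructor
  · exact fun h => h.1
  · rintro rfl
    simp

lemma matchingsIn_empty (r : ℕ) : matchingsIn G ∅ (r + 1) = ∅ := by
  ext M
  simp only [Set.mem_empty_iff_false, iff_false]
  rintro ⟨hc, hM, -⟩
  obtain ⟨e, he⟩ := Finset.card_pos.1 (by omega : 0 < M.card)
  obtain ⟨v, hv⟩ : ∃ v, v ∈ e := by
    induction e with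
    | _ x y => exact ⟨x, by simp⟩
  exact (hM e he).2 v hv

lemma inducedPoly_empty : inducedPoly G ∅ = 1 := by
  simp [inducedPoly, matchingsIn_zero]

variable [Finite V]

lemma matchingsIn_succ_ncard {S : Set V} {u : V} (hu : u ∈ S) (r : ℕ) :
    (matchingsIn G S (r + 1)).ncard = (matchingsIn G (S \ {u}) (r + 1)).ncard +
      ∑ i ∈ nbrsIn G S u, (matchingsIn G ((S \ {u}) \ {i}) r).ncard := by
  classical
  have hnot : ∀ i, ∀ M ∈ matchingsIn G ((S \ {u}) \ {i}) r, s(u, i) ∉ M := fun i M hM h =>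
    ((hM.2.1 _ h).2 u (by simp)).1.2 rfl
  have hun : matchingsIn G S (r + 1) = matchingsIn G (S \ {u}) (r + 1) ∪
      ⋃ i ∈ nbrsIn G S u, insert s(u, i) '' matchingsIn G ((S \ {u}) \ {i}) r := by
    ext M
    simp only [Set.mem_union, Set.mem_iUnion, Set.mem_image, mem_nbrsIn, exists_prop]
    constructor
    · rintro ⟨hc, hM, hp⟩
      by_cases hcov : ∃ e ∈ M, u ∈ e
      · obtain ⟨e, he, hue⟩ := hcov
        obtain ⟨i, rfl⟩ := hue
        right
        obtain ⟨hadj, hin⟩ := hM _ he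
        refine ⟨i, ⟨hin i (by simp), hadj⟩, M.erase s(u, i), ⟨?_, ?_, ?_⟩,
          Finset.insert_erase he⟩
        · rw [Finset.card_erase_of_mem he, hc]; rfl
        · intro f hf
          obtain ⟨hfe, hfM⟩ := Finset.mem_erase.1 hf
          refine ⟨(hM f hfM).1, fun v hv => ⟨⟨(hM f hfM).2 v hv, ?_⟩, ?_⟩⟩
          · rintro rfl
            exact hp (hfM) he hfe _ hv (by simp)
          · rintro rfl
            exact hp (hfM) he hfe _ hv (by simp)
        · exact hp.mono (by simp)
      · push Not at hcov
        left
        refine ⟨hc, fun e he => ⟨(hM e he).1, fun v hv => ⟨(hM e he).2 v hv, ?_⟩⟩, hp⟩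
        rintro rfl
        exact hcov e he hv
    · rintro (⟨hc, hM, hp⟩ | ⟨i, ⟨hi, hadj⟩, M, hMi, rfl⟩)
      · exact ⟨hc, fun e he => ⟨(hM e he).1, fun v hv => ((hM e he).2 v hv).1⟩, hp⟩
      · have hn := hnot i M hMi
        obtain ⟨hc, hM, hp⟩ := hMi
        refine ⟨by rw [Finset.card_insert_of_notMem hn, hc], ?_, ?_⟩
        · intro e he
          rcases Finset.mem_insert.1 he with rfl | he
          · refine ⟨hadj, fun v hv => ?_⟩
            rcases Sym2.mem_iff.1 hv with rfl | rfl <;> assumption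
          · exact ⟨(hM e he).1, fun v hv => ((hM e he).2 v hv).1.1⟩
        · rw [Finset.coe_insert]
          refine hp.insert fun e he _ => ?_
          have key : ∀ v ∈ s(u, i), v ∉ e := ?_
          · exact ⟨key, fun v hve hv => key v hv hve⟩
          intro v hv hve
          have := (hM e he).2 v hve
          rcases Sym2.mem_iff.1 hv with rfl | rfl
          · exact this.1.2 rfl
          · exact this.2 rfl
  have hdisj : Disjoint (matchingsIn G (S \ {u}) (r + 1))
      (⋃ i ∈ nbrsIn G S u, insert s(u, i) '' matchingsIn G ((S \ {u}) \ {i}) r) := by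
    rw [Set.disjoint_left]
    intro M hM h
    simp only [Set.mem_iUnion, Set.mem_image] at h
    obtain ⟨i, -, M, -, rfl⟩ := h
    exact ((hM.2.1 s(u, i) (by simp)).2 u (by simp)).2 rfl
  have hpair : (nbrsIn G S u : Set V).PairwiseDisjoint
      (fun i => insert s(u, i) '' matchingsIn G ((S \ {u}) \ {i}) r) := by
    intro i hi j hj hij
    rw [Function.onFun, Set.disjoint_left]
    rintro _ ⟨M, hM, rfl⟩ ⟨M', hM', heq⟩
    have hmem : s(u, j) ∈ insert s(u, i) M := heq ▸ Finset.mem_insert_self _ _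
    rcases Finset.mem_insert.1 hmem with h | h
    · exact hij (Sym2.congr_right.1 h).symm
    · exact ((hM.2.1 _ h).2 u (by simp)).1.2 rfl
  rw [hun, Set.ncard_union_eq hdisj (Set.toFinite _) (Set.toFinite _)]
  congr 1
  have hbi := (nbrsIn G S u).finite_toSet.ncard_biUnion (fun i _ => Set.toFinite _) hpair
  rw [finsum_mem_coe_finset] at hbi
  simp only [Finset.mem_coe] at hbi
  rw [hbi]
  refine Finset.sum_congr rfl fun i _ => Set.InjOn.ncard_image fun M hM M' hM' heq => ?_
  rw [← Finset.erase_insert (hnot i M hM), heq, Finset.erase_insert (hnot i M' hM')]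

lemma matchingsIn_ncard_eq_zero {S : Set V} {r : ℕ} (h : S.ncard < 2 * r) :
    (matchingsIn G S r).ncard = 0 := by
  induction hn : S.ncard using Nat.strong_induction_on generalizing S r with
  | _ n ih =>
    cases r with
    | zero => omega
    | succ r =>
      rcases S.eq_empty_or_nonempty with rfl | ⟨u, hu⟩
      · simp [matchingsIn_empty]
      have hc := Set.ncard_sdiff_singleton_add_one hu
      rw [matchingsIn_succ_ncard hu, ih _ (by omega) (by omega) rfl, zero_add]
      refine Finset.sum_eq_zero fun i hi => ?_
      rw [mem_nbrsIn] at hi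
      have hc' := Set.ncard_sdiff_singleton_add_one (s := S \ {u}) (a := i) ⟨hi.1, hi.2.ne'⟩
      exact ih _ (by omega) (by omega) rfl

lemma inducedPoly_eq_sum_range {S : Set V} {N : ℕ} (h : S.ncard + 1 ≤ N) :
    inducedPoly G S = ∑ r ∈ Finset.range N,
      C ((-1 : ℝ) ^ r * ((matchingsIn G S r).ncard : ℝ)) * X ^ (S.ncard - 2 * r) := by
  refine Finset.sum_subset (Finset.range_mono h) fun r _ hr => ?_
  rw [matchingsIn_ncard_eq_zero (by simp at hr; omega)]
  simp

lemma vertexRec_inducedPoly (G : SimpleGraph V) : VertexRec G (fun _ => X) (inducedPoly G) := by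
  intro S u hu
  have hc := Set.ncard_sdiff_singleton_add_one hu
  have h1 : X * inducedPoly G (S \ {u}) = X ^ S.ncard + ∑ r ∈ Finset.range S.ncard,
      C ((-1 : ℝ) ^ (r + 1) * ((matchingsIn G (S \ {u}) (r + 1)).ncard : ℝ)) *
        X ^ (S.ncard - 2 * (r + 1)) := by
    rw [inducedPoly_eq_sum_range (N := S.ncard + 1) (by omega), Finset.sum_range_succ', mul_add,
      add_comm, Finset.mul_sum]
    congr 1
    · simp [matchingsIn_zero, ← hc, pow_succ']
    · refine Finset.sum_congr rfl fun r _ => ?_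
      rcases lt_or_ge (S \ {u}).ncard (2 * (r + 1)) with hlt | hge
      · simp [matchingsIn_ncard_eq_zero hlt]
      · rw [← hc, Nat.sub_add_comm hge, pow_succ]
        ring
  have h2 : ∀ i ∈ nbrsIn G S u, inducedPoly G ((S \ {u}) \ {i}) =
      ∑ r ∈ Finset.range S.ncard,
        C ((-1 : ℝ) ^ r * ((matchingsIn G ((S \ {u}) \ {i}) r).ncard : ℝ)) *
          X ^ (S.ncard - 2 * (r + 1)) := by
    intro i hi
    rw [mem_nbrsIn] at hi
    have hc' := Set.ncard_sdiff_singleton_add_one (s := S \ {u}) (a := i) ⟨hi.1, hi.2.ne'⟩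
    rw [inducedPoly_eq_sum_range (N := S.ncard) (by omega)]
    refine Finset.sum_congr rfl fun r _ => ?_
    congr 2
    omega
  rw [h1, Finset.sum_congr rfl h2, Finset.sum_comm, add_sub_assoc, ← Finset.sum_sub_distrib,
    inducedPoly_eq_sum_range le_rfl, Finset.sum_range_succ', add_comm]
  congr 1
  · simp [matchingsIn_zero]
  · refine Finset.sum_congr rfl fun r _ => ?_
    rw [matchingsIn_succ_ncard hu, ← Finset.sum_mul, ← sub_mul, ← map_sum, ← map_sub,
      ← Finset.mul_sum]
    push_cast
    congr 2
    ring

/-- Multiplicativity of the matching polynomial over unions with no edges in between. -/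
lemma inducedPoly_union {S T : Set V} (hd : Disjoint S T)
    (h : ∀ x ∈ S, ∀ y ∈ T, ¬ G.Adj x y) :
    inducedPoly G (S ∪ T) = inducedPoly G S * inducedPoly G T := by
  induction hn : S.ncard using Nat.strong_induction_on generalizing S with
  | _ n ih =>
    rcases S.eq_empty_or_nonempty with rfl | ⟨u, hu⟩
    · simp [inducedPoly_empty]
    have hlt {R : Set V} {v : V} (hv : v ∈ R) : (R \ {v}).ncard < R.ncard :=
      Set.ncard_sdiff_singleton_lt_of_mem hv
    have hsd : ∀ R : Set V, R ⊆ S → ∀ v ∈ R, (R ∪ T) \ {v} = (R \ {v}) ∪ T := by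
      intro R hR v hv
      rw [Set.union_sdiff_distrib, Set.sdiff_singleton_eq_self (Set.disjoint_left.1 hd (hR hv))]
    have hnb : nbrsIn G (S ∪ T) u = nbrsIn G S u := by
      ext i
      simp only [mem_nbrsIn, Set.mem_union]
      exact ⟨fun hi => ⟨hi.1.resolve_right fun hT => h u hu i hT hi.2, hi.2⟩,
        fun hi => ⟨.inl hi.1, hi.2⟩⟩
    rw [vertexRec_inducedPoly G (S ∪ T) u (.inl hu), vertexRec_inducedPoly G S u hu, hnb,
      hsd S subset_rfl u hu, ih _ (hn ▸ hlt hu) (hd.mono_left Set.sdiff_subset)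
        (fun x hx => h x hx.1) rfl, sub_mul, Finset.sum_mul, mul_assoc]
    congr 1
    refine Finset.sum_congr rfl fun i hi => ?_
    rw [mem_nbrsIn] at hi
    have hi' : i ∈ S \ {u} := ⟨hi.1, hi.2.ne'⟩
    rw [hsd _ Set.sdiff_subset i hi', ih _ (hn ▸ (hlt hi').trans (hlt hu))
      (hd.mono_left (Set.sdiff_subset.trans Set.sdiff_subset)) (fun x hx => h x hx.1.1) rfl]

end InducedPoly

section Components

/-- The multiplicity of `θ` as a root of the matching polynomial of `G` induced on `S`. -/
noncomputable def multIn (θ : ℝ) (G : SimpleGraph V) (S : Set V) : ℕ :=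
  (inducedPoly G S).rootMultiplicity θ

variable {θ : ℝ} {G : SimpleGraph V}

lemma mult_eq_multIn {W : Type*} {H : SimpleGraph W} (φ : H ↪g G) :
    mult θ H = multIn θ G (Set.range φ) := by
  rw [mult, multIn, matchingPoly_eq_inducedPoly φ]

lemma mult_induce (S : Set V) : mult θ (G.induce S) = multIn θ G S := by
  rw [mult_eq_multIn (SimpleGraph.Embedding.induce S)]
  congr 1
  exact Subtype.range_coe

lemma mult_eq_multIn_univ : mult θ G = multIn θ G Set.univ := by
  rw [mult_eq_multIn (SimpleGraph.Embedding.refl (G := G))]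
  congr 1
  exact Set.range_id

lemma mult_deleteVert_induce {S : Set V} (u : S) :
    mult θ (deleteVert (G.induce S) u) = multIn θ G (S \ {(u : V)}) := by
  rw [deleteVert, mult_eq_multIn ((SimpleGraph.Embedding.induce S).comp
    (SimpleGraph.Embedding.induce ({u}ᶜ : Set S)))]
  congr 1
  ext x
  constructor
  · rintro ⟨y, rfl⟩
    exact ⟨y.1.2, fun h => y.2 (Subtype.ext h)⟩
  · rintro ⟨hx, hxu⟩
    exact ⟨⟨⟨x, hx⟩, fun h => hxu (congrArg Subtype.val h)⟩, rfl⟩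

lemma isEssential_induce_iff {S : Set V} (u : S) :
    IsEssential θ (G.induce S) u ↔ multIn θ G (S \ {(u : V)}) + 1 = multIn θ G S := by
  rw [IsEssential, mult_deleteVert_induce, mult_induce]

lemma isEssential_iff (u : V) :
    IsEssential θ G u ↔ multIn θ G (Set.univ \ {u}) + 1 = multIn θ G Set.univ := by
  rw [IsEssential, deleteVert, mult_induce, mult_eq_multIn_univ, Set.compl_eq_univ_sdiff]

lemma isCritical_induce_iff {S : Set V} : IsCritical θ (G.induce S) ↔
    (∀ u ∈ S, multIn θ G (S \ {u}) + 1 = multIn θ G S) ∧ multIn θ G S = 1 := by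
  simp only [IsCritical, isEssential_induce_iff, mult_induce, Subtype.forall]

lemma multIn_empty : multIn θ G ∅ = 0 := by
  rw [multIn, inducedPoly_empty, ← C_1, rootMultiplicity_C]

lemma not_adj_of_mem_supp {c : G.ConnectedComponent} {x y : V} (hx : x ∈ c.supp)
    (hy : y ∉ c.supp) : ¬ G.Adj x y := fun h =>
  hy (c.mem_supp_of_adj_mem_supp hx h)

open Classical in
lemma numCritComponents_eq_sum [Fintype G.ConnectedComponent] :
    numCritComponents θ G =
      ∑ c : G.ConnectedComponent, if IsCritical θ (G.induce c.supp) then 1 else 0 := by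
  rw [numCritComponents, Nat.card_eq_fintype_card, Fintype.card_subtype, Finset.card_filter]

open Classical in
lemma ite_isCritical_le_multIn (c : G.ConnectedComponent) :
    (if IsCritical θ (G.induce c.supp) then 1 else 0) ≤ multIn θ G c.supp := by
  split_ifs with h
  · exact (isCritical_induce_iff.1 h).2.ge
  · exact Nat.zero_le _

variable [Finite V]

lemma multIn_union {S T : Set V} (hd : Disjoint S T) (h : ∀ x ∈ S, ∀ y ∈ T, ¬ G.Adj x y) :
    multIn θ G (S ∪ T) = multIn θ G S + multIn θ G T := by
  have hne := (vertexRec_inducedPoly G).ne_zero inducedPoly_empty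
  rw [multIn, inducedPoly_union hd h, rootMultiplicity_mul (mul_ne_zero (hne S) (hne T))]
  rfl

/-- **Gallai's lemma**: a connected graph all of whose vertices are essential is critical. -/
lemma multIn_eq_one_of_essential {S : Set V} (hclosed : ∀ x ∈ S, ∀ y, G.Adj x y → y ∈ S)
    (hconn : ∀ x ∈ S, ∀ y ∈ S, G.Reachable x y) (hne : S.Nonempty)
    (hS : ∀ u ∈ S, multIn θ G (S \ {u}) + 1 = multIn θ G S) : multIn θ G S = 1 := by
  have hF := vertexRec_inducedPoly G
  have h0 := inducedPoly_empty (G := G)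
  obtain ⟨u, hu⟩ := hne
  have hpair : ∀ v, Relation.ReflTransGen G.Adj u v →
      v ∈ S ∧ (v ≠ u → multIn θ G S ≤ multIn θ G ((S \ {u}) \ {v}) + 1) := by
    intro v huv
    induction huv with
    | refl => exact ⟨hu, fun h => absurd rfl h⟩
    | @tail v w _ hvw ih =>
      obtain ⟨hv, ih⟩ := ih
      have hw := hclosed v hv w hvw
      refine ⟨hw, fun hwu => ?_⟩
      have hadj := hF.le_of_adj_essential h0 (θ := θ) hv hw hvw (hS v hv) (hS w hw)
      rcases eq_or_ne v u with rfl | hvu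
      · exact hadj
      · refine hF.essential_pair_trans h0 hS hu hv hw hvu hvw.ne hwu.symm ?_ hadj
        rw [sdiff_right_comm]
        exact ih hvu
  have hu1 := hS u hu
  by_contra hne1
  obtain ⟨v, hv, hev⟩ := hF.exists_essential h0 (θ := θ) (S := S \ {u})
    (show 0 < multIn θ G (S \ {u}) by omega)
  have := (hpair v ((SimpleGraph.reachable_iff_reflTransGen u v).1 (hconn u hu v hv.1))).2 hv.2
  simp only [multIn] at *
  omega

lemma multIn_univ_eq_supp_add (c : G.ConnectedComponent) :
    multIn θ G Set.univ = multIn θ G c.supp + multIn θ G c.suppᶜ := by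
  rw [← multIn_union disjoint_compl_right fun x hx y hy => not_adj_of_mem_supp hx hy,
    Set.union_compl_self]

lemma isEssential_iff_supp {c : G.ConnectedComponent} {u : V} (hu : u ∈ c.supp) :
    IsEssential θ G u ↔ multIn θ G (c.supp \ {u}) + 1 = multIn θ G c.supp := by
  have : Set.univ \ {u} = (c.supp \ {u}) ∪ c.suppᶜ := by
    ext x
    by_cases hx : x = u
    · subst hx; simp [hu]
    · simp [hx, em]
  rw [isEssential_iff, this, multIn_union (disjoint_compl_right.mono_left Set.sdiff_subset)
    fun x hx y hy => not_adj_of_mem_supp hx.1 hy, multIn_univ_eq_supp_add c]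
  omega

open Classical in
lemma mult_eq_sum_components [Fintype G.ConnectedComponent] :
    mult θ G = ∑ c : G.ConnectedComponent, multIn θ G c.supp := by
  have key (s : Finset G.ConnectedComponent) :
      multIn θ G (⋃ c ∈ s, c.supp) = ∑ c ∈ s, multIn θ G c.supp := by
    induction s using Finset.induction_on with
    | empty => simp [multIn_empty]
    | insert c s hc ih =>
      have hdis : ∀ y ∈ ⋃ d ∈ s, d.supp, y ∉ c.supp := by
        intro y hy hyc
        simp only [Set.mem_iUnion] at hy
        obtain ⟨d, hd, hyd⟩ := hy
        rw [SimpleGraph.ConnectedComponent.mem_supp_iff] at hyc hyd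
        exact hc (hyc ▸ hyd ▸ hd)
      rw [Finset.set_biUnion_insert, Finset.sum_insert hc, ← ih, multIn_union
        (Set.disjoint_right.2 hdis) fun x hx y hy => not_adj_of_mem_supp hx (hdis y hy)]
  rw [mult_eq_multIn_univ, ← key]
  congr 1
  ext x
  simp

lemma numCritComponents_le_mult : numCritComponents θ G ≤ mult θ G := by
  classical
  have := Fintype.ofFinite G.ConnectedComponent
  rw [numCritComponents_eq_sum, mult_eq_sum_components]
  exact Finset.sum_le_sum fun c _ => ite_isCritical_le_multIn c

/-- Every component carrying the root `θ` is critical exactly when there are no special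
vertices. -/
lemma numCritComponents_eq_mult_iff :
    numCritComponents θ G = mult θ G ↔ specialSet θ G = ∅ := by
  classical
  have := Fintype.ofFinite G.ConnectedComponent
  rw [numCritComponents_eq_sum, mult_eq_sum_components,
    Finset.sum_eq_sum_iff_of_le fun c _ => ite_isCritical_le_multIn c]
  constructor
  · intro h
    rw [Set.eq_empty_iff_forall_notMem]
    rintro u ⟨hu, w, huw, hw⟩
    let c := G.connectedComponentMk u
    have huc : u ∈ c.supp := rfl
    have hwc : w ∈ c.supp := c.mem_supp_of_adj_mem_supp huc huw
    rw [isEssential_iff_supp huc] at hu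
    rw [isEssential_iff_supp hwc] at hw
    have hc := h c (Finset.mem_univ c)
    split_ifs at hc with hcrit
    · exact hu ((isCritical_induce_iff.1 hcrit).1 u huc)
    · omega
  · intro h c _
    split_ifs with hcrit
    · exact (isCritical_induce_iff.1 hcrit).2.symm
    by_contra hpos
    obtain ⟨u, hu, heu⟩ := (vertexRec_inducedPoly G).exists_essential inducedPoly_empty
      (θ := θ) (S := c.supp) (Nat.pos_of_ne_zero (Ne.symm hpos))
    have hreach : ∀ x ∈ c.supp, ∀ y ∈ c.supp, G.Reachable x y := fun x hx y hy =>
      SimpleGraph.ConnectedComponent.exact (hx.trans hy.symm)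
    have hess : ∀ v ∈ c.supp, IsEssential θ G v := by
      intro v hv
      have := (SimpleGraph.reachable_iff_reflTransGen u v).1 (hreach u hu v hv)
      clear hv
      induction this with
      | refl => exact (isEssential_iff_supp hu).2 heu
      | tail _ hvw ih =>
        by_contra hw
        exact Set.eq_empty_iff_forall_notMem.1 h _ ⟨hw, _, hvw.symm, ih⟩
    have hess' : ∀ v ∈ c.supp, multIn θ G (c.supp \ {v}) + 1 = multIn θ G c.supp :=
      fun v hv => (isEssential_iff_supp hv).1 (hess v hv)
    exact hcrit (isCritical_induce_iff.2 ⟨hess', multIn_eq_one_of_essential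
      (fun x hx y hxy => c.mem_supp_of_adj_mem_supp hx hxy) hreach ⟨u, hu⟩ hess'⟩)

end Components

section Barriers

variable {θ : ℝ} {G : SimpleGraph V}

/-- The special vertices of the subgraph of `G` induced on `S`, as vertices of `G`. -/
def specialIn (θ : ℝ) (G : SimpleGraph V) (S : Set V) : Set V :=
  {u | u ∈ S ∧ multIn θ G (S \ {u}) + 1 ≠ multIn θ G S ∧
    ∃ w ∈ S, G.Adj u w ∧ multIn θ G (S \ {w}) + 1 = multIn θ G S}

lemma isSpecial_induce_iff {S : Set V} (u : S) :
    IsSpecial θ (G.induce S) u ↔ (u : V) ∈ specialIn θ G S := by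
  simp only [IsSpecial, isEssential_induce_iff, specialIn, Set.mem_ofPred_eq, u.2, true_and,
    Subtype.exists, SimpleGraph.comap_adj, Function.Embedding.subtype_apply, exists_prop]

lemma specialSet_induce_eq_empty_iff {S : Set V} :
    specialSet θ (G.induce S) = ∅ ↔ specialIn θ G S = ∅ := by
  simp only [Set.eq_empty_iff_forall_notMem]
  exact ⟨fun h u hu => h ⟨u, hu.1⟩ ((isSpecial_induce_iff _).2 hu),
    fun h u hu => h u ((isSpecial_induce_iff _).1 hu)⟩

lemma isBarrier_iff {X : Set V} : IsBarrier θ G X ↔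
    numCritComponents θ (G.induce Xᶜ) = multIn θ G Set.univ + X.ncard := by
  rw [IsBarrier, mult_eq_multIn_univ, deleteSet]

lemma mem_positiveSet_deleteVert_iff {v : V} (u : ({v}ᶜ : Set V)) :
    u ∈ positiveSet θ (deleteVert G v) ↔
      multIn θ G ({v}ᶜ \ {(u : V)}) = multIn θ G {v}ᶜ + 1 ∧ (u : V) ∉ specialIn θ G {v}ᶜ := by
  rw [← isSpecial_induce_iff, ← mult_deleteVert_induce, ← mult_induce]
  rfl

variable [Finite V]

lemma multIn_sdiff_singleton_le {S : Set V} {u : V} (hu : u ∈ S) :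
    multIn θ G (S \ {u}) ≤ multIn θ G S + 1 :=
  (vertexRec_inducedPoly G).le_rootMultiplicity_add_one inducedPoly_empty hu

lemma multIn_sdiff_singleton_of_mem_specialIn {S : Set V} {a : V} (ha : a ∈ specialIn θ G S) :
    multIn θ G (S \ {a}) = multIn θ G S + 1 := by
  obtain ⟨haS, hna, w, hw, haw, hew⟩ := ha
  exact (vertexRec_inducedPoly G).positive_of_special inducedPoly_empty haS hw haw hew hna

/-- The **stability lemma**. -/
lemma specialIn_sdiff_singleton {S : Set V} {a : V} (ha : a ∈ specialIn θ G S) :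
    specialIn θ G (S \ {a}) = specialIn θ G S \ {a} := by
  have hF := vertexRec_inducedPoly G
  have h0 := inducedPoly_empty (G := G)
  have hpa := multIn_sdiff_singleton_of_mem_specialIn ha
  obtain ⟨haS, hna, v, hv, hav, hev⟩ := ha
  have hess : ∀ b ∈ S, b ≠ a → (multIn θ G ((S \ {a}) \ {b}) + 1 = multIn θ G (S \ {a}) ↔
      multIn θ G (S \ {b}) + 1 = multIn θ G S) := by
    intro b hb hba
    constructor
    · intro h
      by_contra hnb
      exact hF.not_essential_of_special h0 haS hv hb hba.symm hav hev hna hnb h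
    · exact fun h => hF.essential_of_positive h0 haS hb hba.symm hpa h
  ext u
  constructor
  · rintro ⟨⟨hu, hua⟩, hnu, w, ⟨hw, hwa⟩, huw, hew⟩
    rw [Ne, hess u hu hua] at hnu
    exact ⟨⟨hu, hnu, w, hw, huw, (hess w hw hwa).1 hew⟩, hua⟩
  · rintro ⟨⟨hu, hnu, w, hw, huw, hew⟩, hua⟩
    have hwa : w ≠ a := by
      rintro rfl
      exact hna hew
    exact ⟨⟨hu, hua⟩, fun h => hnu ((hess u hu hua).1 h), w, ⟨hw, hwa⟩, huw,
      (hess w hw hwa).2 hew⟩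

lemma multIn_specialIn_sdiff {S T : Set V} (hT : T ⊆ specialIn θ G S) :
    multIn θ G (S \ T) = multIn θ G S + T.ncard ∧
      specialIn θ G (S \ T) = specialIn θ G S \ T := by
  induction T, T.toFinite using Set.Finite.induction_on with
  | empty => simp
  | @insert a T ha _ ih =>
    obtain ⟨h1, h2⟩ := ih ((Set.subset_insert a T).trans hT)
    have ha' : a ∈ specialIn θ G (S \ T) := h2 ▸ ⟨hT (Set.mem_insert a T), ha⟩
    have hins : ∀ R : Set V, R \ insert a T = (R \ T) \ {a} := by
      intro R
      rw [Set.insert_eq, Set.union_comm, Set.sdiff_sdiff]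
    rw [hins, hins, multIn_sdiff_singleton_of_mem_specialIn ha', specialIn_sdiff_singleton ha',
      h1, h2, Set.ncard_insert_of_notMem ha]
    exact ⟨by ring, rfl⟩

lemma multIn_sdiff_le {S T : Set V} (hT : T ⊆ S) :
    multIn θ G (S \ T) ≤ multIn θ G S + T.ncard := by
  induction T, T.toFinite using Set.Finite.induction_on with
  | empty => simp
  | @insert a T ha _ ih =>
    have hins : S \ insert a T = (S \ T) \ {a} := by
      rw [Set.insert_eq, Set.union_comm, Set.sdiff_sdiff]
    have h1 := ih ((Set.subset_insert a T).trans hT)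
    have h2 := multIn_sdiff_singleton_le (θ := θ) (G := G) (S := S \ T) (u := a)
      ⟨hT (Set.mem_insert a T), ha⟩
    rw [hins, Set.ncard_insert_of_notMem ha]
    omega

/-- The **Gallai–Edmonds structure theorem**: the special vertices form a barrier. -/
lemma numCritComponents_sdiff_specialIn (S : Set V) :
    numCritComponents θ (G.induce (S \ specialIn θ G S)) =
      multIn θ G S + (specialIn θ G S).ncard := by
  obtain ⟨h1, h2⟩ := multIn_specialIn_sdiff (subset_refl (specialIn θ G S))
  rw [numCritComponents_eq_mult_iff.2 (specialSet_induce_eq_empty_iff.2 (by simpa using h2)),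
    mult_induce, h1]

lemma numCritComponents_induce_le (S : Set V) :
    numCritComponents θ (G.induce S) ≤ multIn θ G S :=
  numCritComponents_le_mult.trans (mult_induce S).le

/-- Every vertex of a barrier is positive. -/
lemma multIn_sdiff_singleton_of_mem_barrier {S X : Set V} (hX : X ⊆ S)
    (hbar : numCritComponents θ (G.induce (S \ X)) = multIn θ G S + X.ncard) {x : V}
    (hx : x ∈ X) : multIn θ G (S \ {x}) = multIn θ G S + 1 := by
  have h1 := numCritComponents_induce_le (θ := θ) (G := G) (S \ X)
  have h2 := multIn_sdiff_singleton_le (θ := θ) (G := G) (hX hx)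
  have h3 := multIn_sdiff_le (θ := θ) (G := G) (S := S \ {x}) (T := X \ {x})
    (Set.sdiff_subset_sdiff_left hX)
  have h4 : (S \ {x}) \ (X \ {x}) = S \ X := by
    ext y
    by_cases hy : y = x
    · subst hy; simp [hx]
    · simp [hy]
  have h5 := Set.ncard_sdiff_singleton_add_one hx
  rw [h4] at h3
  omega

/-- A barrier consisting of special vertices consists of all special vertices. -/
lemma eq_specialIn_of_barrier {S X : Set V} (hX : X ⊆ specialIn θ G S)
    (hbar : numCritComponents θ (G.induce (S \ X)) = multIn θ G S + X.ncard) :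
    X = specialIn θ G S := by
  obtain ⟨h1, h2⟩ := multIn_specialIn_sdiff hX
  rw [← h1, ← mult_induce, numCritComponents_eq_mult_iff, specialSet_induce_eq_empty_iff, h2,
    Set.sdiff_eq_empty] at hbar
  exact hX.antisymm hbar

lemma isBarrier_insert_iff {v : V} {Y : Set V} (hvY : v ∉ Y)
    (hv : multIn θ G {v}ᶜ = multIn θ G Set.univ + 1) : IsBarrier θ G (insert v Y) ↔
      numCritComponents θ (G.induce ({v}ᶜ \ Y)) = multIn θ G {v}ᶜ + Y.ncard := by
  have : (insert v Y)ᶜ = {v}ᶜ \ Y := by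
    rw [Set.insert_eq, Set.compl_union, Set.sdiff_eq]
  rw [isBarrier_iff, this, Set.ncard_insert_of_notMem hvY, hv, add_right_comm, add_assoc]

lemma IsBarrier.eq_insert_specialIn (hG : IsElementary θ G) {X : Set V} (hX : IsBarrier θ G X)
    {v : V} (hv : v ∈ X) : X = insert v (specialIn θ G {v}ᶜ) := by
  obtain ⟨⟨hm, hsp⟩, hpos⟩ := hG
  have hv1 : multIn θ G {v}ᶜ = multIn θ G Set.univ + 1 := by
    rw [← mult_eq_multIn_univ, hm, ← mult_induce]
    exact hsp v
  rw [← Set.insert_sdiff_self_of_mem hv] at hX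
  rw [isBarrier_insert_iff (by simp) hv1] at hX
  have hsub : X \ {v} ⊆ ({v}ᶜ : Set V) := fun x hx => hx.2
  have hspec : X \ {v} ⊆ specialIn θ G {v}ᶜ := by
    intro x hx
    by_contra hns
    have := (mem_positiveSet_deleteVert_iff ⟨x, hsub hx⟩).2
      ⟨multIn_sdiff_singleton_of_mem_barrier hsub hX hx, hns⟩
    simp [hpos v] at this
  rw [← eq_specialIn_of_barrier hspec hX, Set.insert_sdiff_self_of_mem hv]

lemma isBarrier_insert_specialIn {v : V} (hv : multIn θ G {v}ᶜ = multIn θ G Set.univ + 1) :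
    IsBarrier θ G (insert v (specialIn θ G {v}ᶜ)) :=
  (isBarrier_insert_iff (fun h => h.1 rfl) hv).2 (numCritComponents_sdiff_specialIn _)

lemma isElementary_of_barriers
    (hdisj : ∀ X Y : Set V, IsBarrier θ G X → IsBarrier θ G Y → X.Nonempty → Y.Nonempty →
      X ≠ Y → Disjoint X Y)
    (hcov : ∀ v : V, ∃ X : Set V, IsBarrier θ G X ∧ X.Nonempty ∧ v ∈ X) : IsElementary θ G := by
  have hpos : ∀ v, multIn θ G {v}ᶜ = multIn θ G Set.univ + 1 := by
    intro v
    obtain ⟨X, hX, -, hv⟩ := hcov v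
    rw [isBarrier_iff, Set.compl_eq_univ_sdiff] at hX
    rw [Set.compl_eq_univ_sdiff]
    exact multIn_sdiff_singleton_of_mem_barrier (Set.subset_univ X) hX hv
  have hm : multIn θ G Set.univ = 0 := by
    by_contra hne
    obtain ⟨u, -, hu⟩ := (vertexRec_inducedPoly G).exists_essential inducedPoly_empty
      (θ := θ) (S := Set.univ) (Nat.pos_of_ne_zero hne)
    have := hpos u
    rw [Set.compl_eq_univ_sdiff] at this
    simp only [multIn] at this
    omega
  refine ⟨⟨mult_eq_multIn_univ.trans hm, fun v => ?_⟩, fun v => ?_⟩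
  · rw [deleteVert, mult_induce, hpos, hm]
  · rw [Set.eq_empty_iff_forall_notMem]
    intro w hw
    rw [mem_positiveSet_deleteVert_iff] at hw
    obtain ⟨w, hwv⟩ := w
    obtain ⟨hw2, hns⟩ := hw
    have hY : IsBarrier θ G (insert v (insert w (specialIn θ G ({v}ᶜ \ {w})))) := by
      rw [isBarrier_insert_iff _ (hpos v)]
      · have : ({v}ᶜ : Set V) \ insert w (specialIn θ G ({v}ᶜ \ {w})) =
            ({v}ᶜ \ {w}) \ specialIn θ G ({v}ᶜ \ {w}) := by
          rw [Set.insert_eq, Set.sdiff_sdiff]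
        rw [this, numCritComponents_sdiff_specialIn, hw2,
          Set.ncard_insert_of_notMem fun h => h.1.2 rfl]
        ring
      · rintro (rfl | h)
        · exact hwv rfl
        · exact h.1.1 rfl
    have heq : insert v (specialIn θ G {v}ᶜ) =
        insert v (insert w (specialIn θ G ({v}ᶜ \ {w}))) := by
      by_contra hne
      exact Set.disjoint_left.1 (hdisj _ _ (isBarrier_insert_specialIn (hpos v)) hY
        (Set.insert_nonempty _ _) (Set.insert_nonempty _ _) hne) (Set.mem_insert v _)
        (Set.mem_insert v _)
    have hmem : w ∈ insert v (specialIn θ G {v}ᶜ) := by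
      rw [heq]
      simp
    exact hmem.elim hwv hns

end Barriers

/-- G is θ-elementary iff the nonempty θ-barrier sets form a partition of V(G). -/
theorem stmt_8 {V : Type*} [Fintype V] (θ : ℝ) (G : SimpleGraph V) :
    IsElementary θ G ↔
      ((∀ X Y : Set V, IsBarrier θ G X → IsBarrier θ G Y → X.Nonempty → Y.Nonempty →
          X ≠ Y → Disjoint X Y) ∧
        ∀ v : V, ∃ X : Set V, IsBarrier θ G X ∧ X.Nonempty ∧ v ∈ X) := by
  refine ⟨fun hG => ⟨?_, fun v => ⟨insert v (specialIn θ G {v}ᶜ), ?_, Set.insert_nonempty _ _,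
    Set.mem_insert v _⟩⟩, fun h => isElementary_of_barriers h.1 h.2⟩
  · intro X Y hX hY _ _ hne
    rw [Set.disjoint_left]
    intro v hvX hvY
    exact hne ((hX.eq_insert_specialIn hG hvX).trans (hY.eq_insert_specialIn hG hvY).symm)
  · refine isBarrier_insert_specialIn ?_
    rw [← mult_eq_multIn_univ, hG.1.1, ← mult_induce]
    exact hG.1.2 v

end MatchPoly
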